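/- arXiv:1806.00198 — 9 statements merged into one kernel-verified Lean document; each statement's English description precedes it below -/
import Mathlib

section
/- For every nonempty string T, the following recursively defined factorization is a block palindrome factorization of T achieving the maximum possible number of blocks: if T is unbordered, the factorization is the single block (T); otherwise, letting s be the shortest border of T and M the string with T = s·M·s, the factorization is (s) followed by the (recursively obtained) factorization of M (empty if M is empty) followed by (s). -/
variable {α : Type*}

/-- `B` is a border of `S`: a nonempty proper prefix of `S` that is also a suffix of `S`. -/
def IsBorder (B S : List α) : Prop :=
  B ≠ [] ∧ B.length < S.length ∧ B <+: S ∧ B <:+ S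

/-- `S` is unbordered: it has no border. -/
def Unbordered (S : List α) : Prop := ∀ B, ¬ IsBorder B S

/-- `B` is the shortest border of `S`. -/
def ShortestBorder (B S : List α) : Prop :=
  IsBorder B S ∧ ∀ B', IsBorder B' S → B.length ≤ B'.length

/-- `L` is a block palindrome factorization of `T`: a list of nonempty blocks whose
concatenation is `T` and which is equal to its own reversal. -/
def BPFact (T : List α) (L : List (List α)) : Prop :=
  (∀ f ∈ L, f ≠ []) ∧ L.flatten = T ∧ L.reverse = L

/-- The recursively defined factorization of a nonempty string `T`:
if `T` is unbordered, it is the single block `(T)`; otherwise, letting `s` be the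
shortest border of `T` and `M` the string with `T = s ++ M ++ s`, it is `(s)` followed by
the recursively obtained factorization of `M` (empty if `M` is empty) followed by `(s)`. -/
inductive RecFact : List α → List (List α) → Prop
  | unbordered (T : List α) (hT : T ≠ []) (hu : Unbordered T) : RecFact T [T]
  | emptyMid (T s : List α) (hs : ShortestBorder s T) (hT : T = s ++ s) :
      RecFact T [s, s]
  | step (T s M : List α) (L : List (List α)) (hs : ShortestBorder s T)
      (hT : T = s ++ M ++ s) (hM : M ≠ []) (hL : RecFact M L) :
      RecFact T (s :: (L ++ [s]))

theorem aux_unb {s T : List α} (h : ShortestBorder s T) : Unbordered s := by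
  intro B hB
  obtain ⟨⟨h1, h2, h3, h4⟩, h5⟩ := h
  obtain ⟨b1, b2, b3, b4⟩ := hB
  have := h5 B ⟨b1, by omega, b3.trans h3, b4.trans h4⟩
  omega

theorem aux_split {s f : List α} (hu : Unbordered s) (hl : s.length < f.length)
    (hp : s <+: f) (hs : s <:+ f) : ∃ N, f = s ++ N ++ s := by
  obtain ⟨A, rfl⟩ := hp
  obtain ⟨B, hB⟩ := hs
  rcases List.append_eq_append_iff.1 hB with ⟨W, h1, h2⟩ | ⟨N, h1, h2⟩
  · by_cases hW : W = []
    · subst hW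
      exact ⟨[], by simp_all⟩
    · exfalso
      refine hu W ⟨hW, ?_, ⟨A, h2.symm⟩, ⟨B, h1.symm⟩⟩
      have := congrArg List.length h2
      simp at this hl
      omega
  · exact ⟨N, by simp [h2]⟩

theorem aux_exists (n : ℕ) : ∀ T : List α, T.length ≤ n → T ≠ [] → ∃ L, RecFact T L := by
  induction n with
  | zero => intro T h1 h2; simp at h1; exact absurd h1 h2
  | succ n ih =>
    intro T h1 h2
    by_cases hu : Unbordered T
    · exact ⟨_, .unbordered T h2 hu⟩
    · have hex : ∃ k, ∃ B, IsBorder B T ∧ B.length = k := by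
        simp only [Unbordered, not_forall, not_not] at hu
        obtain ⟨B, hB⟩ := hu
        exact ⟨_, B, hB, rfl⟩
      classical
      obtain ⟨s, hs, hk⟩ := Nat.find_spec hex
      have hsb : ShortestBorder s T :=
        ⟨hs, fun B' hB' => hk ▸ Nat.find_min' hex ⟨B', hB', rfl⟩⟩
      obtain ⟨M, hM⟩ := aux_split (aux_unb hsb) hs.2.1 hs.2.2.1 hs.2.2.2
      by_cases hM0 : M = []
      · exact ⟨_, .emptyMid T s hsb (by simpa [hM0] using hM)⟩
      · have hs0 : 0 < s.length := List.length_pos_iff.2 hs.1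
        have hlen := congrArg List.length hM
        simp at hlen
        obtain ⟨L, hL⟩ := ih M (by omega) hM0
        exact ⟨_, .step T s M L hsb hM hM0 hL⟩

theorem aux_bpf {T : List α} {L : List (List α)} (h : RecFact T L) : BPFact T L := by
  induction h with
  | unbordered T hT hu => exact ⟨by simpa using hT, by simp, by simp⟩
  | emptyMid T s hs hT => exact ⟨by simpa using hs.1.1, by simp [hT], by simp⟩
  | step T s M L hs hT hM hL ih =>
    obtain ⟨h1, h2, h3⟩ := ih
    refine ⟨?_, by simp [hT, h2], by simp [h3]⟩
    intro f hf
    simp at hf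
    rcases hf with rfl | hf | rfl
    · exact hs.1.1
    · exact h1 f hf
    · exact hs.1.1

theorem aux_shape {L : List (List α)} (h : L.reverse = L) (hl : 2 ≤ L.length) :
    ∃ f K, L = f :: (K ++ [f]) ∧ K.reverse = K := by
  cases L with
  | nil => simp at hl
  | cons f R =>
    rcases List.eq_nil_or_concat R with rfl | ⟨K, g, rfl⟩
    · simp at hl
    · simp at h
      obtain ⟨rfl, h⟩ := h
      simp at h
      exact ⟨g, K, by simp, h⟩

theorem aux_key {T s M : List α} {L : List (List α)} (hs : ShortestBorder s T)
    (hT : T = s ++ M ++ s) (hL : BPFact T L) (hl : 2 ≤ L.length) :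
    ∃ L', BPFact M L' ∧ L.length ≤ L'.length + 2 := by
  obtain ⟨h1, h2, h3⟩ := hL
  obtain ⟨f, K, rfl, hK⟩ := aux_shape h3 hl
  have hf0 : f ≠ [] := h1 f (by simp)
  have hKn : ∀ x ∈ K, x ≠ [] := fun x hx => h1 x (by simp [hx])
  have hTf : T = f ++ K.flatten ++ f := by simp [← h2]
  have hfl : 0 < f.length := List.length_pos_iff.2 hf0
  have hfp : f <+: T := ⟨K.flatten ++ f, by simp [hTf]⟩
  have hfs : f <:+ T := ⟨f ++ K.flatten, by simp [hTf]⟩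
  have hle : s.length ≤ f.length := by
    refine hs.2 f ⟨hf0, ?_, hfp, hfs⟩
    rw [hTf]; simp; omega
  have hsp : s <+: f := List.prefix_of_prefix_length_le hs.1.2.2.1 hfp hle
  have hss : s <:+ f := List.suffix_of_suffix_length_le hs.1.2.2.2 hfs hle
  rcases hle.eq_or_lt with he | hlt
  · obtain rfl : s = f := hsp.eq_of_length he
    refine ⟨K, ⟨hKn, ?_, hK⟩, by simp⟩
    rw [hT] at hTf
    simpa using hTf.symm
  · obtain ⟨N, rfl⟩ := aux_split (aux_unb hs) hlt hsp hss
    have hM : M = N ++ s ++ K.flatten ++ s ++ N := by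
      rw [hT] at hTf
      have : s ++ (M ++ s) = s ++ ((N ++ s ++ K.flatten ++ s ++ N) ++ s) := by
        simpa using hTf
      exact List.append_cancel_right (List.append_cancel_left this)
    have hs0 := hs.1.1
    by_cases hN : N = []
    · subst hN
      refine ⟨s :: (K ++ [s]), ⟨?_, by simp [hM], by simp [hK]⟩, by simp⟩
      intro x hx
      simp at hx
      rcases hx with rfl | hx | rfl
      exacts [hs0, hKn x hx, hs0]
    · refine ⟨N :: s :: (K ++ [s, N]), ⟨?_, by simp [hM], by simp [hK]⟩, by simp⟩
      intro x hx
      simp at hx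
      rcases hx with rfl | rfl | hx | rfl | rfl
      exacts [hN, hs0, hKn x hx, hs0, hN]

theorem aux_max {T : List α} {L : List (List α)} (h : RecFact T L) :
    ∀ L', BPFact T L' → L'.length ≤ L.length := by
  induction h with
  | unbordered T hT hu =>
    intro L' hL'
    by_contra hc
    simp at hc
    obtain ⟨h1, h2, h3⟩ := hL'
    obtain ⟨f, K, rfl, hK⟩ := aux_shape h3 hc
    have hf0 : f ≠ [] := h1 f (by simp)
    have hfl : 0 < f.length := List.length_pos_iff.2 hf0
    refine hu f ⟨hf0, ?_, ⟨K.flatten ++ f, by simp [← h2]⟩, ⟨f ++ K.flatten, by simp [← h2]⟩⟩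
    rw [← h2]; simp; omega
  | emptyMid T s hs hT =>
    intro L' hL'
    by_cases hl : 2 ≤ L'.length
    · obtain ⟨K, ⟨k1, k2, k3⟩, hk⟩ := aux_key (M := []) hs (by simpa using hT) hL' hl
      have : K = [] := by
        cases K with
        | nil => rfl
        | cons x K => simp at k2; exact absurd k2.1 (k1 x (by simp))
      subst this
      simpa using hk
    · simp; omega
  | step T s M L hs hT hM hL ih =>
    intro L' hL'
    by_cases hl : 2 ≤ L'.length
    · obtain ⟨K, hK, hk⟩ := aux_key hs hT hL' hl
      have := ih K hK
      simp; omega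
    · simp; omega

/-- For every nonempty string `T`, the recursively defined factorization exists, is a
block palindrome factorization of `T`, and achieves the maximum possible number of blocks. -/
theorem recursive_factorization_is_largest_BPF (T : List α) (hT : T ≠ []) :
    (∃ L, RecFact T L) ∧
    ∀ L, RecFact T L →
      BPFact T L ∧ ∀ L', BPFact T L' → L'.length ≤ L.length :=  by
  exact ⟨aux_exists _ T le_rfl hT, fun L hL => ⟨aux_bpf hL, aux_max hL⟩⟩
end

section
/- For every nonempty string T, the block palindrome factorization of T with the maximum number of blocks is unique: if L and L' are two block palindrome factorizations of T both having the maximum possible size, then L = L'. -/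
variable {α : Type*}

theorem exists_short_border (n : ℕ) : ∀ (B S : List α), B.length = n → IsBorder B S →
    ∃ b w, b ≠ [] ∧ S = b ++ w ++ b := by
  induction n using Nat.strong_induction_on with
  | _ n ih =>
    intro B S hn hB
    obtain ⟨hne, hlt, ⟨u, hu⟩, ⟨v, hv⟩⟩ := hB
    have hlu : B.length + u.length = S.length := by rw [← hu]; simp
    have hlv : v.length + B.length = S.length := by rw [← hv]; simp
    have h : B ++ u = v ++ B := by rw [hu, hv]
    rcases List.append_eq_append_iff.1 h with ⟨c, hc, -⟩ | ⟨c, hc, hc'⟩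
    · exact ⟨B, c, hne, by rw [← hv, hc]⟩
    · by_cases hc0 : c = []
      · subst hc0
        simp only [List.append_nil] at hc
        exact ⟨B, [], hne, by rw [← hv, ← hc]; simp⟩
      · have hl : B.length = v.length + c.length := by rw [hc]; simp
        refine ih c.length (by omega) c S rfl ⟨hc0, by omega, ?_, ?_⟩
        · exact List.IsPrefix.trans ⟨u, hc'.symm⟩ ⟨u, hu⟩
        · exact List.IsSuffix.trans ⟨v, hc.symm⟩ ⟨v, hv⟩

theorem outer_unbordered (x : List α) (M : List (List α)) (T : List α)
    (hL : BPFact T (x :: (M ++ [x])))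
    (hmax : ∀ K, BPFact T K → K.length ≤ (x :: (M ++ [x])).length) : Unbordered x := by
  intro B hB
  obtain ⟨b, w, hb, rfl⟩ := exists_short_border _ B x rfl hB
  obtain ⟨h1, h2, h3⟩ := hL
  have hM : M.reverse = M := by simpa using h3
  have hMne : ∀ f ∈ M, f ≠ [] := fun f hf => h1 f (by simp [hf])
  by_cases hw : w = []
  · subst hw
    have := hmax (b :: b :: (M ++ [b, b])) ⟨?_, ?_, ?_⟩
    · simp at this
    · intro f hf
      simp only [List.mem_cons, List.mem_append, List.not_mem_nil, or_false] at hf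
      rcases hf with rfl | rfl | hf | rfl | rfl <;> first | assumption | exact hMne _ hf
    · rw [← h2]; simp
    · simp [hM]
  · have := hmax (b :: w :: b :: (M ++ [b, w, b])) ⟨?_, ?_, ?_⟩
    · simp at this
    · intro f hf
      simp only [List.mem_cons, List.mem_append, List.not_mem_nil, or_false] at hf
      rcases hf with rfl | rfl | rfl | hf | rfl | rfl | rfl <;>
        first | assumption | exact hMne _ hf
    · rw [← h2]; simp
    · simp [hM]

theorem outer_eq (x y s t : List α) (hx : x ≠ []) (hy : Unbordered y)
    (h : x ++ (s ++ x) = y ++ (t ++ y)) (hle : x.length ≤ y.length) : x = y := by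
  have hp : x <+: y := List.prefix_of_prefix_length_le ⟨_, rfl⟩ ⟨_, h.symm⟩ hle
  have hs : x <:+ y :=
    List.suffix_of_suffix_length_le (l₃ := x ++ (s ++ x)) ⟨x ++ s, by simp⟩
      ⟨y ++ t, by rw [h]; simp⟩ hle
  rcases Nat.lt_or_ge x.length y.length with hlt | hge
  · exact absurd ⟨hx, hlt, hp, hs⟩ (hy x)
  · exact hp.eq_of_length_le hge

theorem inner_max (x : List α) (M : List (List α)) (hx : x ≠ [])
    (hmax : ∀ K, BPFact (x :: (M ++ [x])).flatten K → K.length ≤ (x :: (M ++ [x])).length) :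
    ∀ K, BPFact M.flatten K → K.length ≤ M.length := by
  rintro K ⟨k1, k2, k3⟩
  have := hmax (x :: (K ++ [x])) ⟨?_, ?_, ?_⟩
  · simpa using this
  · intro f hf
    simp only [List.mem_cons, List.mem_append, List.not_mem_nil, or_false] at hf
    rcases hf with rfl | hf | rfl
    · exact hx
    · exact k1 _ hf
    · exact hx
  · simp [k2]
  · simp [k3]

theorem unique_aux (L : List (List α)) (hp : L.Palindrome) : ∀ (T : List α) (L' : List (List α)),
    BPFact T L → BPFact T L' → (∀ K, BPFact T K → K.length ≤ L.length) →
    (∀ K, BPFact T K → K.length ≤ L'.length) → L = L' := by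
  induction hp with
  | nil =>
    intro T L' hL hL' hm hm'
    have := hm _ hL'
    exact (List.length_eq_zero_iff.1 (by simpa using this)).symm
  | singleton x =>
    intro T L' hL hL' hm hm'
    have h1 := hm _ hL'
    have h2 := hm' _ hL
    obtain ⟨y, rfl⟩ := List.length_eq_one_iff.1 (le_antisymm h1 h2)
    have := hL.2.1.trans hL'.2.1.symm
    simpa using this
  | @cons_concat x M hM ih =>
    intro T L' hL hL' hm hm'
    have hlen := le_antisymm (hm _ hL') (hm' _ hL)
    have hp' := List.Palindrome.of_reverse_eq hL'.2.2
    cases hp' with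
    | nil => simp at hlen
    | singleton y => simp at hlen
    | @cons_concat y N hN =>
      have hux := outer_unbordered x M T hL hm
      have huy := outer_unbordered y N T hL' hm'
      have hx : x ≠ [] := hL.1 x (by simp)
      have hy : y ≠ [] := hL'.1 y (by simp)
      have e : x ++ (M.flatten ++ x) = y ++ (N.flatten ++ y) := by
        have := hL.2.1.trans hL'.2.1.symm
        simpa using this
      have hxy : x = y := by
        rcases Nat.le_total x.length y.length with h | h
        · exact outer_eq x y _ _ hx huy e h
        · exact (outer_eq y x _ _ hy hux e.symm h).symm
      subst hxy
      have eMN : M.flatten = N.flatten := by simpa using e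
      have h1 := inner_max x M hx (by rw [hL.2.1]; exact hm)
      have h2 := inner_max x N hx (by rw [hL'.2.1]; exact hm')
      rw [← eMN] at h2
      have := ih M.flatten N ⟨fun f hf => hL.1 f (by simp [hf]), rfl, hM.reverse_eq⟩
        ⟨fun f hf => hL'.1 f (by simp [hf]), eMN.symm, hN.reverse_eq⟩ h1 h2
      rw [this]

/-- For every nonempty string `T`, the block palindrome factorization of `T` with the
maximum number of blocks is unique. -/
theorem largest_BPF_unique (T : List α) (hT : T ≠ []) (L L' : List (List α))
    (hL : BPFact T L) (hL' : BPFact T L')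
    (hmax : ∀ K, BPFact T K → K.length ≤ L.length)
    (hmax' : ∀ K, BPFact T K → K.length ≤ L'.length) :
    L = L' := by
  exact unique_aux L (List.Palindrome.of_reverse_eq hL.2.2) T L' hL hL' hmax hmax'
end

section
/- In the largest block palindrome of a nonempty string T, every block is an unbordered string. -/
variable {α : Type*}

theorem bpf_split_aux (f : List α) : ∀ (n : ℕ) (B : List α), B.length ≤ n → IsBorder B f →
    ∃ G, BPFact f G ∧ 2 ≤ G.length := by
  intro n
  induction n with
  | zero =>
    intro B hn hB
    exact absurd (List.length_eq_zero_iff.mp (by omega)) hB.1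
  | succ n ih =>
    rintro B hn ⟨h0, hlt, ⟨t, ht⟩, ⟨s, hs⟩⟩
    have hpos : 0 < B.length := List.length_pos_iff.mpr h0
    have hl1 : B.length + t.length = f.length := by rw [← ht]; simp
    have hl2 : s.length + B.length = f.length := by rw [← hs]; simp
    by_cases hc : B.length ≤ s.length
    · have hp : B <+: s :=
        List.prefix_of_prefix_length_le ⟨t, ht⟩ ⟨B, hs⟩ hc
      obtain ⟨m, rfl⟩ := hp
      by_cases hm : m = []
      · subst hm
        exact ⟨[B, B], ⟨by simp [h0], by simpa using hs, by simp⟩, by simp⟩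
      · exact ⟨[B, m, B], ⟨by simp [h0, hm], by simpa using hs, by simp⟩, by simp⟩
    · have hp : s <+: B :=
        List.prefix_of_prefix_length_le ⟨B, hs⟩ ⟨t, ht⟩ (by omega)
      obtain ⟨B', hB'⟩ := hp
      have hl3 : s.length + B'.length = B.length := by rw [← hB']; simp
      have h1 : B' ++ t = B := by
        have h2 : s ++ (B' ++ t) = s ++ B := by
          rw [hs, ← List.append_assoc, hB', ht]
        exact List.append_cancel_left h2
      refine ih B' (by omega) ⟨?_, by omega, ?_, ?_⟩
      · rw [← List.length_pos_iff]; omega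
      · exact List.IsPrefix.trans ⟨t, h1⟩ ⟨t, ht⟩
      · exact List.IsSuffix.trans ⟨s, hB'⟩ ⟨s, hs⟩

theorem largest_BPF_blocks_unbordered (T : List α) (hT : T ≠ []) (L : List (List α))
    (hL : BPFact T L) (hmax : ∀ K, BPFact T K → K.length ≤ L.length) :
    ∀ f ∈ L, Unbordered f := by
  classical
  intro f hf B hB
  obtain ⟨G, ⟨hG0, hG1, hG2⟩, hG3⟩ := bpf_split_aux f _ B le_rfl hB
  obtain ⟨hL0, hL1, hL2⟩ := hL
  let g : List α → List (List α) := fun x => if x = f then G else [x]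
  have hgf : ∀ x, (g x).flatten = x := by
    intro x; by_cases h : x = f <;> simp [g, h, hG1]
  have hgr : ∀ x, (g x).reverse = g x := by
    intro x; by_cases h : x = f <;> simp [g, h, hG2]
  have hgl : ∀ x, 1 ≤ (g x).length := by
    intro x; by_cases h : x = f <;> simp [g, h]; omega
  have hfl : ∀ M : List (List α), (M.flatMap g).flatten = M.flatten := by
    intro M; induction M with
    | nil => rfl
    | cons a M ih => simp [List.flatMap_cons, ih, hgf]
  have hrev : ∀ M : List (List α), (M.flatMap g).reverse = M.reverse.flatMap g := by
    intro M; induction M with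
    | nil => rfl
    | cons a M ih => simp [List.flatMap_cons, List.flatMap_append, ih, hgr]
  have hle : ∀ M : List (List α), M.length ≤ (M.flatMap g).length := by
    intro M; induction M with
    | nil => simp
    | cons a M ih =>
      have := hgl a
      rw [List.flatMap_cons, List.length_append, List.length_cons]; omega
  have hK := hmax (L.flatMap g) ⟨?_, by rw [hfl, hL1], by rw [hrev, hL2]⟩
  · obtain ⟨L1, L2, rfl⟩ := List.append_of_mem hf
    have e1 := hle L1
    have e2 := hle L2
    have e3 : (g f).length = G.length := by simp [g]
    rw [List.flatMap_append, List.flatMap_cons] at hK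
    simp only [List.length_append, List.length_cons] at hK
    omega
  · intro x hx
    obtain ⟨y, hy, hxy⟩ := List.mem_flatMap.mp hx
    by_cases h : y = f
    · exact hG0 x (by simpa [g, h] using hxy)
    · have : x = y := by simpa [g, h] using hxy
      exact this ▸ hL0 y hy
end

section
/- A block palindrome factorization of a nonempty string T in which every block is unbordered is necessarily the largest block palindrome of T; that is, a block palindrome factorization of T has the maximum number of blocks if and only if all of its blocks are unbordered. -/
variable {α : Type*}

theorem bpf_split {f g : List α} (hf : Unbordered f) (hp : f <+: g) (hs : f <:+ g)
    (hl : f.length < g.length) : ∃ m, g = f ++ m ++ f := by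
  obtain ⟨s, rfl⟩ := hp
  obtain ⟨t, ht⟩ := hs
  rcases List.append_eq_append_iff.1 ht with ⟨c, h1, h2⟩ | ⟨c, h1, h2⟩
  · by_cases hc : c = []
    · subst hc
      exact ⟨[], by simp_all⟩
    · exfalso
      refine hf c ⟨hc, ?_, ⟨s, h2.symm⟩, ⟨t, h1.symm⟩⟩
      have e1 := congrArg List.length h2
      simp only [List.length_append] at e1 hl
      omega
  · exact ⟨c, by rw [h2, List.append_assoc]⟩

theorem exists_unbordered_border (n : ℕ) : ∀ (S B : List α), B.length ≤ n → IsBorder B S →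
    ∃ C, IsBorder C S ∧ Unbordered C := by
  induction n with
  | zero =>
    intro S B hn hB
    exact absurd (List.length_eq_zero_iff.1 (by omega)) hB.1
  | succ n ih =>
    intro S B hn hB
    by_cases hu : Unbordered B
    · exact ⟨B, hB, hu⟩
    · simp only [Unbordered, not_forall, not_not] at hu
      obtain ⟨D, hD⟩ := hu
      obtain ⟨d0, d1, d2, d3⟩ := hD
      exact ih S D (by omega) ⟨d0, by have := hB.2.1; omega, d2.trans hB.2.2.1, d3.trans hB.2.2.2⟩

theorem bpf_le {L : List (List α)} (hL : L.Palindrome) :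
    (∀ f ∈ L, f ≠ []) → (∀ f ∈ L, Unbordered f) →
    ∀ K : List (List α), K.Palindrome → (∀ f ∈ K, f ≠ []) → K.flatten = L.flatten →
      K.length ≤ L.length := by
  induction hL with
  | nil =>
    intro _ _ K _ hK h
    cases K with
    | nil => simp
    | cons a K =>
      exfalso
      simp at h
      exact hK a (by simp) h.1
  | singleton f =>
    intro h0 hu K hK hK0 h
    cases hK with
    | nil => simp
    | singleton g => simp
    | @cons_concat g K' hp =>
      exfalso
      have hg := hK0 g (by simp)
      have hgl := List.length_pos_iff.2 hg
      simp at h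
      refine hu f (by simp) g ⟨hg, ?_, ⟨K'.flatten ++ g, h⟩, ⟨g ++ K'.flatten, by simpa using h⟩⟩
      rw [← h]; simp; omega
  | @cons_concat f L' hp ih =>
    intro h0 hu K hK hK0 h
    have ih := ih (fun x hx => h0 x (by simp [hx])) (fun x hx => hu x (by simp [hx]))
    have hf0 := h0 f (by simp)
    have hfu := hu f (by simp)
    cases hK with
    | nil => simp
    | singleton g => simp
    | @cons_concat g K' hp' =>
      have hg0 := hK0 g (by simp)
      have hK0' : ∀ x ∈ K', x ≠ [] := fun x hx => hK0 x (by simp [hx])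
      have h : g ++ (K'.flatten ++ g) = f ++ (L'.flatten ++ f) := by simpa using h
      have h2 : (g ++ K'.flatten) ++ g = (f ++ L'.flatten) ++ f := by simpa using h
      have pg : g <+: f ++ (L'.flatten ++ f) := ⟨_, h⟩
      have pf : f <+: f ++ (L'.flatten ++ f) := ⟨_, rfl⟩
      have sg : g <:+ (f ++ L'.flatten) ++ f := ⟨_, h2⟩
      have sf : f <:+ (f ++ L'.flatten) ++ f := ⟨_, rfl⟩
      rcases lt_trichotomy g.length f.length with hlt | heq | hgt
      · exfalso
        exact hfu g ⟨hg0, hlt, List.prefix_of_prefix_length_le pg pf hlt.le,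
          List.suffix_of_suffix_length_le sg sf hlt.le⟩
      · have e : g = f := (List.prefix_of_prefix_length_le pg pf heq.le).eq_of_length heq
        subst e
        have := ih K' hp' hK0' (by simpa using h)
        simpa using this
      · obtain ⟨m, rfl⟩ := bpf_split hfu (List.prefix_of_prefix_length_le pf pg hgt.le)
          (List.suffix_of_suffix_length_le sf sg hgt.le) hgt
        have h3 : m ++ (f ++ (K'.flatten ++ (f ++ m))) = L'.flatten := by
          have : f ++ ((m ++ (f ++ (K'.flatten ++ (f ++ m)))) ++ f) = f ++ (L'.flatten ++ f) := by
            simpa using h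
          exact List.append_cancel_right (List.append_cancel_left this)
        have hq : (f :: (K' ++ [f])).Palindrome := hp'.cons_concat f
        by_cases hm : m = []
        · subst hm
          have := ih _ hq (by
            intro x hx
            simp at hx
            rcases hx with rfl | hx | rfl
            exacts [hf0, hK0' x hx, hf0]) (by simpa using h3)
          simp at this ⊢
          omega
        · have := ih _ (hq.cons_concat m) (by
            intro x hx
            simp at hx
            rcases hx with rfl | rfl | hx | rfl | rfl
            exacts [hm, hf0, hK0' x hx, hf0, hm]) (by simpa using h3)
          simp at this ⊢
          omega

theorem bpf_refine (P : List α → List (List α)) (hrev : ∀ x, (P x).reverse = P x)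
    (L : List (List α)) : (L.flatMap P).reverse = L.reverse.flatMap P := by
  induction L with
  | nil => simp
  | cons a L ih => simp [ih, hrev]

theorem bpf_flat (P : List α → List (List α)) (hfl : ∀ x, (P x).flatten = x)
    (L : List (List α)) : (L.flatMap P).flatten = L.flatten := by
  induction L with
  | nil => simp
  | cons a L ih => simp [ih, hfl]

theorem bpf_len (P : List α → List (List α)) (h1 : ∀ x, 1 ≤ (P x).length)
    (L : List (List α)) : L.length ≤ (L.flatMap P).length := by
  induction L with
  | nil => simp
  | cons a L ih =>
    have := h1 a
    simp only [List.flatMap_cons, List.length_append, List.length_cons]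
    omega

/-- A block palindrome factorization of a nonempty string `T` has the maximum number of
blocks if and only if all of its blocks are unbordered. -/
theorem largest_BPF_iff_all_blocks_unbordered (T : List α) (hT : T ≠ [])
    (L : List (List α)) (hL : BPFact T L) :
    (∀ K, BPFact T K → K.length ≤ L.length) ↔ (∀ f ∈ L, Unbordered f) := by
  classical
  obtain ⟨hL0, hLT, hLr⟩ := hL
  constructor
  · intro hmax f hf B hB
    obtain ⟨C, hC, hCu⟩ := exists_unbordered_border _ f B le_rfl hB
    obtain ⟨m, hm⟩ := bpf_split hCu hC.2.2.1 hC.2.2.2 hC.2.1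
    obtain ⟨Q, hQr, hQf, hQ0, hQl⟩ : ∃ Q : List (List α), Q.reverse = Q ∧ Q.flatten = f ∧
        (∀ x ∈ Q, x ≠ []) ∧ 2 ≤ Q.length := by
      by_cases h : m = []
      · exact ⟨[C, C], by simp, by simp [hm, h], by simp [hC.1], by simp⟩
      · exact ⟨[C, m, C], by simp, by simp [hm], by simp [hC.1, h], by simp⟩
    let P : List α → List (List α) := fun x => if x = f then Q else [x]
    have hPf : P f = Q := by simp [P]
    have hP1 : ∀ x, 1 ≤ (P x).length := by
      intro x; simp only [P]; split_ifs; { omega }; { simp }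
    have hK : BPFact T (L.flatMap P) := by
      refine ⟨?_, ?_, ?_⟩
      · intro x hx
        obtain ⟨a, ha, hxa⟩ := List.mem_flatMap.1 hx
        simp only [P] at hxa
        split_ifs at hxa
        · exact hQ0 x hxa
        · simp at hxa; exact hxa ▸ hL0 a ha
      · rw [bpf_flat P _ L, hLT]
        intro x; simp only [P]; split_ifs with h
        · rw [hQf, h]
        · simp
      · rw [bpf_refine P _ L, hLr]
        intro x; simp only [P]; split_ifs with h
        · exact hQr
        · simp
    have hle := hmax _ hK
    obtain ⟨s, t, rfl⟩ := List.append_of_mem hf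
    have h1 := bpf_len P hP1 s
    have h2 := bpf_len P hP1 t
    simp only [List.flatMap_append, List.flatMap_cons, List.length_append, List.length_cons,
      hPf] at hle
    omega
  · intro hu K ⟨hK0, hKT, hKr⟩
    exact bpf_le (List.Palindrome.of_reverse_eq hLr) hL0 hu K
      (List.Palindrome.of_reverse_eq hKr) hK0 (hKT.trans hLT.symm)
end

section
/- If a nonempty string T has a border, then the outermost block (i.e., the first, equivalently the last, element) of the largest block palindrome of T equals the shortest border of T. -/
variable {α : Type*}

theorem shortestBorder_split {s f : List α} (h : ShortestBorder s f) : ∃ x, f = s ++ (x ++ s) := by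
  obtain ⟨⟨hne, hlt, hp, hsuf⟩, hmin⟩ := h
  obtain ⟨r, hr⟩ := hp
  obtain ⟨q, hq⟩ := hsuf
  have l1 := congrArg List.length hr
  have l2 := congrArg List.length hq
  simp only [List.length_append] at l1 l2
  by_cases hc : s.length ≤ r.length
  · have h1 : s <:+ r := List.suffix_of_suffix_length_le ⟨q, hq⟩ ⟨s, hr⟩ hc
    obtain ⟨x, hx⟩ := h1
    exact ⟨x, by rw [hx, hr]⟩
  · exfalso
    have h1 : q <+: s := List.prefix_of_prefix_length_le ⟨s, hq⟩ ⟨r, hr⟩ (by omega)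
    obtain ⟨o, ho⟩ := h1
    have l3 := congrArg List.length ho
    simp only [List.length_append] at l3
    have h2 : s = o ++ r := by
      have : q ++ s = q ++ (o ++ r) := by
        rw [hq, ← List.append_assoc, ho, hr]
      exact List.append_cancel_left this
    have hb : IsBorder o f := by
      refine ⟨?_, by omega, ?_, ?_⟩
      · rintro rfl
        simp at l3
        omega
      · exact List.IsPrefix.trans ⟨r, h2.symm⟩ ⟨r, hr⟩
      · exact List.IsSuffix.trans ⟨q, ho⟩ ⟨q, hq⟩
    have := hmin o hb
    omega

theorem exists_bpfact (x : List α) : ∃ E, BPFact x E := by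
  by_cases hx : x = []
  · exact ⟨[], by simp [BPFact, hx]⟩
  · exact ⟨[x], by simp [BPFact, hx]⟩

/-- If a nonempty string `T` has a border, then the outermost block (the first,
equivalently the last, element) of the largest block palindrome of `T` equals the
shortest border of `T`. -/
theorem largest_BPF_outermost_block_eq_shortest_border (T : List α) (hT : T ≠ [])
    (hB : ∃ B, IsBorder B T) (L : List (List α))
    (hL : BPFact T L) (hmax : ∀ K, BPFact T K → K.length ≤ L.length)
    (s : List α) (hs : ShortestBorder s T) :
    L.head? = some s ∧ L.getLast? = some s := by
  have hs' := hs
  obtain ⟨⟨hne, hlt, hp, hsuf⟩, hmin⟩ := hs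
  obtain ⟨hLne, hLf, hLr⟩ := hL
  have hpal : L.Palindrome := List.Palindrome.of_reverse_eq hLr
  cases hpal with
  | nil => simp at hLf; exact absurd hLf hT
  | singleton f =>
    exfalso
    obtain ⟨x, hx⟩ := shortestBorder_split hs'
    obtain ⟨E, hE1, hE2, hE3⟩ := exists_bpfact x
    have := hmax ([s] ++ (E ++ [s])) ⟨by
      intro f hf
      simp only [List.mem_append, List.mem_singleton] at hf
      rcases hf with rfl | hf | rfl
      · exact hne
      · exact hE1 f hf
      · exact hne, by simp [hE2, hx], by simp [hE3]⟩
    simp at this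
  | @cons_concat f M hM =>
    have hMr := hM.reverse_eq
    have hfne : f ≠ [] := hLne f (by simp)
    have hflen : 0 < f.length := List.length_pos_iff.2 hfne
    have hT' : T = f ++ (M.flatten ++ f) := by rw [← hLf]; simp
    have lT := congrArg List.length hT'
    simp only [List.length_append] at lT
    have fp : f <+: T := ⟨_, hT'.symm⟩
    have fs : f <:+ T := ⟨f ++ M.flatten, by rw [hT']; simp⟩
    have hle := hmin f ⟨hfne, by omega, fp, fs⟩
    have sp : s <+: f := List.prefix_of_prefix_length_le hp fp hle
    have ss : s <:+ f := List.suffix_of_suffix_length_le hsuf fs hle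
    rcases hle.eq_or_lt with heq | hlt'
    · have : s = f := sp.eq_of_length heq
      subst this
      simp [List.getLast?_cons]
    · exfalso
      have hsb : ShortestBorder s f := by
        refine ⟨⟨hne, hlt', sp, ss⟩, ?_⟩
        rintro B ⟨h1, h2, h3, h4⟩
        exact hmin B ⟨h1, by omega, h3.trans fp, h4.trans fs⟩
      obtain ⟨x, hx⟩ := shortestBorder_split hsb
      obtain ⟨E, hE1, hE2, hE3⟩ := exists_bpfact x
      have := hmax ([s] ++ E ++ [s] ++ M ++ [s] ++ E ++ [s]) ⟨by
        intro g hg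
        simp only [List.mem_append, List.mem_singleton] at hg
        have hMne : g ∈ M → g ≠ [] := fun h => hLne g (by simp [h])
        have hEg := hE1 g
        have hsg : g = s → g ≠ [] := fun h => h ▸ hne
        tauto, by rw [hT', hx]; simp [hE2], by simp [hE3, hMr]⟩
      simp at this
      omega
end

section
/- Let S and S' be nonempty strings with S' = u·S·v for strings u, v with |u| = |v|, let L be the largest block palindrome of S and M the largest block palindrome of S', and suppose L and M have the same center block, i.e., either both have even size, or both have odd size and their middle blocks are equal with the middle block of M occupying exactly the positions of the middle block of L inside S' (equivalently, M's center block equals L's center block at the aligned center). Then L is a centered sub-factorization of M: there is a list of strings P with M = P ++ L ++ reverse(P). -/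
variable {α : Type*}

theorem exists_square_border (f : List α) : ∀ (n : ℕ) (B x y : List α), B.length ≤ n → B ≠ [] →
    x ≠ [] → f = B ++ x → f = y ++ B → ∃ B z, B ≠ [] ∧ f = B ++ z ++ B := by
  intro n
  induction n with
  | zero =>
    intro B x y hn hB
    exact absurd (List.length_eq_zero_iff.mp (Nat.le_zero.mp hn)) hB
  | succ n ih =>
    intro B x y hn hB hx h1 h2
    have h : B ++ x = y ++ B := h1.symm.trans h2
    rcases List.append_eq_append_iff.mp h with ⟨z, hz1, hz2⟩ | ⟨z, hz1, hz2⟩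
    · exact ⟨B, z, hB, by rw [h2, hz1]⟩
    · by_cases hz : z = []
      · subst hz
        refine ⟨B, [], hB, ?_⟩
        rw [h2]
        simp at hz1
        simp [hz1]
      · have hy : y.length = x.length := by
          have := congrArg List.length h
          simp at this
          omega
        have hxl := List.length_pos_iff.mpr hx
        have hBl := congrArg List.length hz1
        simp at hBl
        refine ih z (x ++ x) (y ++ y) (by omega) hz (by simp [hx]) ?_ ?_
        · rw [h1, hz2]; simp
        · rw [h2, hz1]; simp

theorem pal_split {β : Type*} (L : List β) (h : L.reverse = L) : ∃ R C, L = R.reverse ++ C ++ R ∧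
    C.reverse = C ∧ (Even L.length → C = []) ∧ (Odd L.length → C = L[L.length / 2]?.toList) := by
  rcases Nat.even_or_odd L.length with he | ho
  · obtain ⟨k, hk⟩ := he
    refine ⟨L.drop k, [], ?_, rfl, fun _ => rfl,
      fun ho => absurd ho (Nat.not_odd_iff_even.mpr ⟨k, hk⟩)⟩
    have h1 : L.take k = (L.drop k).reverse := by
      rw [List.reverse_drop, h]
      congr 1
      omega
    rw [← h1]
    simp
  · obtain ⟨k, hk⟩ := ho
    have hd : L.length / 2 = k := by omega
    refine ⟨L.drop (k + 1), L[k]?.toList, ?_, ?_,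
      fun he => absurd ⟨k, hk⟩ (Nat.not_odd_iff_even.mpr he), fun _ => by rw [hd]⟩
    · have h1 : L.take k = (L.drop (k + 1)).reverse := by
        rw [List.reverse_drop, h]
        congr 1
        omega
      rw [← h1, ← List.take_add_one]
      simp
    · cases L[k]? <;> simp

theorem length_flatten_rev (R : List (List α)) :
    R.reverse.flatten.length = R.flatten.length := by
  simp [List.length_flatten]

theorem core_prefix (R₁ : List (List α)) : ∀ (R₂ : List (List α)) (c u v : List α),
    u.length = v.length →
    (∀ f ∈ R₁, f ≠ [] ∧ ¬ ∃ B z, B ≠ [] ∧ f = B ++ z ++ B) →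
    (∀ f ∈ R₂, f ≠ [] ∧ ¬ ∃ B z, B ≠ [] ∧ f = B ++ z ++ B) →
    u ++ (R₁.reverse.flatten ++ c ++ R₁.flatten) ++ v = R₂.reverse.flatten ++ c ++ R₂.flatten →
    R₁ <+: R₂ := by
  induction R₁ with
  | nil => intros; exact List.nil_prefix
  | cons f R₁ ih =>
    intro R₂ c u v huv h1 h2 h
    have hf := h1 f (by simp)
    have hlen := congrArg List.length h
    have e1 := length_flatten_rev R₁
    cases R₂ with
    | nil =>
      have := List.length_pos_iff.mpr hf.1
      simp only [List.reverse_cons, List.flatten_append, List.flatten_cons, List.flatten_nil,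
        List.length_append, List.reverse_nil, List.length_nil] at hlen
      omega
    | cons g R₂ =>
      have hg := h2 g (by simp)
      have e2 := length_flatten_rev R₂
      simp only [List.reverse_cons, List.flatten_append, List.flatten_cons, List.flatten_nil,
        List.append_nil, List.length_append] at hlen h
      have h' : (u ++ R₁.reverse.flatten ++ f) ++ (c ++ (f ++ (R₁.flatten ++ v))) =
          (R₂.reverse.flatten ++ g) ++ (c ++ (g ++ R₂.flatten)) := by
        simpa using h
      obtain ⟨hl, hr⟩ := List.append_inj h' (by simp only [List.length_append]; omega)
      have hr := List.append_cancel_left hr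
      have hfg : f = g := by
        rcases List.append_eq_append_iff.mp hl with ⟨y, hy1, hy2⟩ | ⟨y, hy1, hy2⟩ <;>
        rcases List.append_eq_append_iff.mp hr with ⟨x, hx1, hx2⟩ | ⟨x, hx1, hx2⟩
        · have := congrArg List.length hy2
          have := congrArg List.length hx1
          simp only [List.length_append] at *
          have : x = [] := List.length_eq_zero_iff.mp (by omega)
          simpa [this] using hx1.symm
        · by_contra hne
          refine hf.2 (exists_square_border f _ g x y le_rfl hg.1 ?_ hx1 hy2)
          rintro rfl
          simp at hx1
          exact hne hx1
        · by_contra hne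
          refine hg.2 (exists_square_border g _ f x y le_rfl hf.1 ?_ hx1 hy2)
          rintro rfl
          simp at hx1
          exact hne hx1.symm
        · have := congrArg List.length hy2
          have := congrArg List.length hx1
          simp only [List.length_append] at *
          have : x = [] := List.length_eq_zero_iff.mp (by omega)
          simpa [this] using hx1
      subst hfg
      rw [List.prefix_cons_inj]
      refine ih R₂ (f ++ c ++ f) u v huv (fun a ha => h1 a (by simp [ha]))
        (fun a ha => h2 a (by simp [ha])) ?_
      simpa using h

theorem blocks_unbordered (S : List α) (R C : List (List α)) (hC : C.reverse = C)
    (hL : BPFact S (R.reverse ++ C ++ R))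
    (hmax : ∀ K, BPFact S K → K.length ≤ (R.reverse ++ C ++ R).length) :
    ∀ f ∈ R, f ≠ [] ∧ ¬ ∃ B z, B ≠ [] ∧ f = B ++ z ++ B := by
  intro f hf
  refine ⟨hL.1 f (by simp [hf]), ?_⟩
  rintro ⟨B, z, hB, rfl⟩
  obtain ⟨Q, hQ0, hQ1, hQ2, hQ3⟩ : ∃ Q : List (List α), (∀ f ∈ Q, f ≠ []) ∧
      Q.flatten = B ++ z ++ B ∧ Q.reverse = Q ∧ 2 ≤ Q.length := by
    by_cases hz : z = []
    · exact ⟨[B, B], by simp [hB], by simp [hz], rfl, by simp⟩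
    · exact ⟨[B, z, B], by simp [hB, hz], by simp, rfl, by simp⟩
  obtain ⟨R1, R2, rfl⟩ := List.append_of_mem hf
  have := hmax ((R1 ++ Q ++ R2).reverse ++ C ++ (R1 ++ Q ++ R2)) ⟨?_, ?_, ?_⟩
  · simp at this
    omega
  · intro g hg
    by_cases hgQ : g ∈ Q
    · exact hQ0 g hgQ
    · apply hL.1 g
      simp [hgQ] at hg ⊢
      tauto
  · rw [← hL.2.1]
    simp [hQ1, hQ2]
  · simp [hC]

/-- Let `S' = u ++ S ++ v` with `|u| = |v|`, let `L` be the largest block palindrome of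
`S` and `M` the largest block palindrome of `S'`, and suppose `L` and `M` have the same
center block: either both have even size, or both have odd size and their middle blocks
are equal (with `|u| = |v|`, equality of the middle blocks means the middle block of `M`
occupies exactly the positions of the middle block of `L` inside `S'`).
Then `L` is a centered sub-factorization of `M`: `M = P ++ L ++ reverse P` for some
list of strings `P`. -/
theorem largest_BPF_centered_subfactorization (S S' u v : List α) (L M : List (List α))
    (hS : S ≠ []) (hS' : S' ≠ [])
    (hSS' : S' = u ++ S ++ v) (huv : u.length = v.length)
    (hL : BPFact S L) (hLmax : ∀ K, BPFact S K → K.length ≤ L.length)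
    (hM : BPFact S' M) (hMmax : ∀ K, BPFact S' K → K.length ≤ M.length)
    (hcenter : (Even L.length ∧ Even M.length) ∨
      (Odd L.length ∧ Odd M.length ∧ L[L.length / 2]? = M[M.length / 2]?)) :
    ∃ P, M = P ++ L ++ P.reverse := by
  obtain ⟨R₁, C, hL1, hC, hLe, hLo⟩ := pal_split L hL.2.2
  obtain ⟨R₂, D, hM1, hD, hMe, hMo⟩ := pal_split M hM.2.2
  have hCD : C = D := by
    rcases hcenter with ⟨a, b⟩ | ⟨a, b, c⟩
    · rw [hLe a, hMe b]
    · rw [hLo a, hMo b, c]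
  clear hLe hLo hMe hMo hcenter
  subst hCD hL1 hM1
  have key := core_prefix R₁ R₂ C.flatten u v huv (blocks_unbordered S R₁ C hC hL hLmax)
    (blocks_unbordered S' R₂ C hC hM hMmax) (by
      have e1 := hL.2.1
      have e2 := hM.2.1
      simp only [List.flatten_append] at e1 e2
      rw [e1, e2, hSS'])
  obtain ⟨T, rfl⟩ := key
  exact ⟨T.reverse, by simp⟩
end

section
/- Let T be a string of length N, let c be a half-position of T, and let d < d' be half-integers. Let f = f_{−n}⋯f_n ∈ F_T(c,d) and g = g_{−m}⋯g_m ∈ F_T(c,d') be largest block palindromes of centered substrings of T with center c and center blocks T[c−d+1 .. c+d−1] and T[c−d'+1 .. c+d'−1] respectively. Then f and g share no block boundary on the right of the center: for all 1 ≤ i ≤ n and 1 ≤ j ≤ m, c + d − 1 + |f_1⋯f_i| ≠ c + d' − 1 + |g_1⋯g_j|. -/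
variable {α : Type*}

/-- `L` is the largest block palindrome (factorization) of `T`: a block palindrome
factorization of `T` with the maximum possible number of blocks. -/
def LargestBPF (T : List α) (L : List (List α)) : Prop :=
  BPFact T L ∧ ∀ K, BPFact T K → K.length ≤ L.length

/-- The substring `T[b..e)` in 0-based half-open coordinates. -/
def Substr (T : List α) (b e : ℕ) : List α := (T.drop b).take (e - b)

/-- `L ∈ F_T(c, d)`, where the (possibly empty) center block occupies the interval
`[p, q)` of `T` in 0-based half-open coordinates (in the paper's notation,
`p = c - d` and `q = c + d - 1`, so the center block is `T[c-d+1 .. c+d-1]`):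
`L` is a largest block palindrome of the substring of `T` occupying `[p - k, q + k)`,
where `k = |f_1 ⋯ f_n|` is the total length of the blocks to the right of the
center block, and the center block of `L` is `T[p..q)`. -/
def MemF (T : List α) (p q : ℕ) (L : List (List α)) : Prop :=
  p ≤ q ∧ q ≤ T.length ∧ L ≠ [] ∧
  ∃ k, k ≤ p ∧ q + k ≤ T.length ∧
    LargestBPF (Substr T (p - k) (q + k)) L ∧
    k = ((L.drop ((L.length + 1) / 2)).flatten).length ∧
    ((p = q ∧ Even L.length) ∨
     (p < q ∧ Odd L.length ∧ L[L.length / 2]? = some (Substr T p q)))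

/-- A maximal block palindrome of `T` with center block occupying `[p, q)`:
an element of `F_T(c, d)` of maximal total length. -/
def MaximalBP (T : List α) (p q : ℕ) (L : List (List α)) : Prop :=
  MemF T p q L ∧ ∀ K, MemF T p q K → K.flatten.length ≤ L.flatten.length

theorem aux_border_split : ∀ (n : ℕ) (S B : List α), B.length ≤ n → IsBorder B S →
    ∃ b z, b ≠ [] ∧ S = b ++ z ++ b := by
  intro n
  induction n with
  | zero =>
    intro S B hn hB
    exact absurd (List.length_eq_zero_iff.1 (Nat.le_zero.1 hn)) hB.1
  | succ n ih =>
    intro S B hn hB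
    obtain ⟨hne, hlt, ⟨x, hx⟩, ⟨y, hy⟩⟩ := hB
    have hlx : B.length + x.length = S.length := by rw [← hx]; simp
    have hly : y.length + B.length = S.length := by rw [← hy]; simp
    by_cases h : B.length ≤ y.length
    · have hp : B <+: y := List.prefix_of_prefix_length_le ⟨x, hx⟩ ⟨B, hy⟩ h
      obtain ⟨z, hz⟩ := hp
      exact ⟨B, z, hne, by rw [hz, hy]⟩
    · push Not at h
      have hp : y <+: B := List.prefix_of_prefix_length_le ⟨B, hy⟩ ⟨x, hx⟩ h.le
      obtain ⟨c, hc⟩ := hp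
      have hlc : y.length + c.length = B.length := by rw [← hc]; simp
      have hcx : c ++ x = B := by
        have h1 : y ++ (c ++ x) = y ++ B := by
          rw [← List.append_assoc, hc, hx, hy]
        exact List.append_cancel_left h1
      refine ih S c (by omega) ⟨?_, by omega, ?_, ?_⟩
      · rintro rfl
        simp at hlc
        omega
      · exact (show c <+: B from ⟨x, hcx⟩).trans ⟨x, hx⟩
      · exact (show c <:+ B from ⟨y, hc⟩).trans ⟨y, hy⟩

theorem aux_inner (A M : List (List α))
    (h : LargestBPF (A ++ M ++ A.reverse).flatten (A ++ M ++ A.reverse)) :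
    LargestBPF M.flatten M := by
  obtain ⟨⟨h1, -, h3⟩, h4⟩ := h
  refine ⟨⟨fun f hf => h1 f (by simp [hf]), rfl, ?_⟩, ?_⟩
  · simpa using h3
  · intro K hK
    have := h4 (A ++ K ++ A.reverse) ⟨?_, ?_, ?_⟩
    · simpa using this
    · intro f hf
      simp only [List.mem_append, List.mem_reverse] at hf
      rcases hf with (hf | hf) | hf
      · exact h1 f (by simp [hf])
      · exact hK.1 f hf
      · exact h1 f (by simp [hf])
    · simp [hK.2.1]
    · simp [hK.2.2]

theorem aux_first_unbordered (y : List α) (N : List (List α)) (S : List α)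
    (h : LargestBPF S ([y] ++ N ++ [y])) (B : List α) (hB : IsBorder B y) : False := by
  obtain ⟨b, z, hb, rfl⟩ := aux_border_split _ y B le_rfl hB
  obtain ⟨⟨h1, h2, h3⟩, h4⟩ := h
  have h3' : N.reverse = N := by simpa using h3
  have hN : ∀ f ∈ N, f ≠ [] := fun f hf => h1 f (by simp [hf])
  by_cases hz : z = []
  · subst hz
    have := h4 ([b, b] ++ N ++ [b, b]) ⟨?_, ?_, ?_⟩
    · simp at this
    · intro f hf
      simp at hf
      rcases hf with rfl | hf | rfl
      · exact hb
      · exact hN f hf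
      · exact hb
    · rw [← h2]; simp
    · simp [h3']
  · have := h4 ([b, z, b] ++ N ++ [b, z, b]) ⟨?_, ?_, ?_⟩
    · simp at this
    · intro f hf
      simp only [List.mem_append, List.mem_cons, List.not_mem_nil, or_false] at hf
      rcases hf with ((rfl | rfl | rfl) | hf) | (rfl | rfl | rfl)
      any_goals assumption
      exact hN f hf
    · rw [← h2]; simp
    · simp [h3']

theorem aux_first_le (x y : List α) (M N : List (List α)) (S : List α)
    (hx : LargestBPF S ([x] ++ M ++ [x])) (hy : LargestBPF S ([y] ++ N ++ [y])) :
    y.length ≤ x.length := by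
  by_contra hlt
  push Not at hlt
  have ex : S = x ++ M.flatten ++ x := by rw [← hx.1.2.1]; simp
  have ey : S = y ++ N.flatten ++ y := by rw [← hy.1.2.1]; simp
  refine aux_first_unbordered y N S hy x ⟨hx.1.1 x (by simp), hlt, ?_, ?_⟩
  · exact List.prefix_of_prefix_length_le (l₃ := S) ⟨M.flatten ++ x, by rw [ex]; simp⟩
      ⟨N.flatten ++ y, by rw [ey]; simp⟩ hlt.le
  · exact List.suffix_of_suffix_length_le (l₃ := S) ⟨x ++ M.flatten, by rw [ex]⟩
      ⟨y ++ N.flatten, by rw [ey]⟩ hlt.le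

theorem aux_unique (L : List (List α)) (hL : L.Palindrome) :
    ∀ (S : List α) (K : List (List α)), LargestBPF S L → LargestBPF S K → L = K := by
  induction hL with
  | nil =>
    intro S K h1 h2
    have := h1.2 K h2.1
    simpa [eq_comm] using this
  | singleton x =>
    intro S K h1 h2
    have ha := h1.2 K h2.1
    have hb := h2.2 _ h1.1
    obtain ⟨y, rfl⟩ := List.length_eq_one_iff.1 (le_antisymm ha hb)
    have e1 := h1.1.2.1
    have e2 := h2.1.2.1
    simp at e1 e2
    rw [e1, e2]
  | @cons_concat x M hM ih =>
    intro S K h1 h2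
    have ha := h1.2 K h2.1
    have hb := h2.2 _ h1.1
    have hK := List.Palindrome.of_reverse_eq h2.1.2.2
    cases hK with
    | nil => simp at hb
    | singleton y => simp at hb
    | @cons_concat y N hN =>
      have h1' : LargestBPF S ([x] ++ M ++ [x]) := by simpa using h1
      have h2' : LargestBPF S ([y] ++ N ++ [y]) := by simpa using h2
      have hlen := le_antisymm (aux_first_le y x N M S h2' h1') (aux_first_le x y M N S h1' h2')
      have ex : x ++ (M.flatten ++ x) = S := by rw [← h1'.1.2.1]; simp
      have ey : y ++ (N.flatten ++ y) = S := by rw [← h2'.1.2.1]; simp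
      obtain ⟨rfl, e⟩ := List.append_inj (ex.trans ey.symm) hlen
      have e' := List.append_cancel_right e
      have i1 := aux_inner [x] M (by rw [List.reverse_singleton, h1'.1.2.1]; exact h1')
      have i2 := aux_inner [x] N (by
        have := h2'.1.2.1
        simp only [List.reverse_singleton]
        rw [this]; exact h2')
      rw [ih _ N i1 (e' ▸ i2)]

theorem aux_memF (T : List α) (p q : ℕ) (L : List (List α)) (h : MemF T p q L)
    (i : ℕ) (hi : i ≤ L.length / 2) (R : List (List α))
    (hR : R = (L.drop ((L.length + 1) / 2)).take i) :
    R.length = i ∧ R.flatten.length ≤ p ∧ ∃ C : List (List α), C.length ≤ 1 ∧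
      LargestBPF (Substr T (p - R.flatten.length) (q + R.flatten.length))
        (R.reverse ++ C ++ R) := by
  obtain ⟨hpq, hqT, -, k, hkp, hkT, hLg, hk, hc⟩ := h
  obtain ⟨C, hC1, hC2, hC⟩ : ∃ C : List (List α), C.length ≤ 1 ∧ C.flatten.length = q - p ∧
      L = L.take (L.length / 2) ++ C ++ L.drop ((L.length + 1) / 2) := by
    rcases hc with ⟨h1, h2⟩ | ⟨h1, h2, h3⟩
    · refine ⟨[], by simp, by simp [h1], ?_⟩
      have : (L.length + 1) / 2 = L.length / 2 := by
        obtain ⟨m, hm⟩ := h2; omega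
      rw [this]; simp
    · refine ⟨[Substr T p q], by simp, ?_, ?_⟩
      · simp [Substr]; omega
      · have : (L.length + 1) / 2 = L.length / 2 + 1 := by
          obtain ⟨m, hm⟩ := h2; omega
        rw [this]
        obtain ⟨hlt, he⟩ := List.getElem?_eq_some_iff.1 h3
        rw [← he, List.append_assoc, List.singleton_append, List.getElem_cons_drop,
          List.take_append_drop]
  have hpal := hLg.1.2.2
  have htake : L.take (L.length / 2) = (L.drop ((L.length + 1) / 2)).reverse := by
    rw [List.reverse_drop, hpal]; congr 1; omega
  set D := L.drop ((L.length + 1) / 2) with hD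
  have hDl : D.length = L.length / 2 := by rw [hD, List.length_drop]; omega
  set R' := D.drop i with hR'
  have hDR : D = R ++ R' := by rw [hR, hR', List.take_append_drop]
  rw [htake] at hC
  have hrev : ∀ X : List (List α), X.reverse.flatten.length = X.flatten.length := by
    intro X
    simp [List.length_flatten, List.sum_reverse]
  have hkk : k = R.flatten.length + R'.flatten.length := by
    rw [hk, hDR]; simp
  have hC' : L = R'.reverse ++ (R.reverse ++ C ++ R) ++ R'.reverse.reverse := by
    rw [hC, hDR]; simp
  have hfl := hLg.1.2.1
  refine ⟨by rw [hR, List.length_take]; omega, by omega, C, hC1, ?_⟩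
  have hin : LargestBPF (R.reverse ++ C ++ R).flatten (R.reverse ++ C ++ R) := by
    apply aux_inner R'.reverse
    rw [← hC', hfl]; exact hLg
  have hml : (R.reverse ++ C ++ R).flatten.length = q - p + 2 * R.flatten.length := by
    rw [List.flatten_append, List.flatten_append, List.length_append, List.length_append,
      hrev, hC2]; omega
  have key : (R.reverse ++ C ++ R).flatten =
      Substr T (p - R.flatten.length) (q + R.flatten.length) := by
    have e1 : (R.reverse ++ C ++ R).flatten =
        (L.flatten.drop (R'.reverse.flatten.length)).take
          (R.reverse ++ C ++ R).flatten.length := by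
      conv_rhs => rw [hC']
      rw [List.flatten_append (L₁ := R'.reverse ++ (R.reverse ++ C ++ R)),
        List.flatten_append (L₁ := R'.reverse), List.append_assoc R'.reverse.flatten, List.drop_left,
        List.take_left]
    rw [e1, hfl, hrev, hml]
    unfold Substr
    rw [List.drop_take, List.drop_drop, List.take_take]
    congr 1
    · omega
    · congr 1; omega
  rw [← key]; exact hin

/-- Two largest block palindromes `f ∈ F_T(c, d)` and `g ∈ F_T(c, d')` with the same
center `c` and `d < d'` share no block boundary to the right of the center.
Here the center blocks occupy `[p, q)` resp. `[p', q')` in 0-based half-open coordinates;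
the same center means `p + q = p' + q'` and `d < d'` means `q < q'`.  The ending position
`c + d - 1 + |f_1 ⋯ f_i|` of the `i`-th right block of `f` is `q` plus the total length
of the first `i` blocks to the right of the center block of `f`. -/
theorem no_shared_block_boundaries (T : List α) (p q p' q' : ℕ)
    (f g : List (List α))
    (hcenter : p + q = p' + q') (hd : q < q')
    (hf : MemF T p q f) (hg : MemF T p' q' g) :
    ∀ i j, 1 ≤ i → i ≤ f.length / 2 → 1 ≤ j → j ≤ g.length / 2 →
      q + (((f.drop ((f.length + 1) / 2)).take i).flatten).length ≠
        q' + (((g.drop ((g.length + 1) / 2)).take j).flatten).length := by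
  intro i j hi hi' hj hj' heq
  obtain ⟨l1, b1, C, c1, g1⟩ := aux_memF T p q f hf i hi' _ rfl
  obtain ⟨l2, b2, C', c2, g2⟩ := aux_memF T p' q' g hg j hj' _ rfl
  set R := (f.drop ((f.length + 1) / 2)).take i
  set R' := (g.drop ((g.length + 1) / 2)).take j
  have e : p - R.flatten.length = p' - R'.flatten.length := by omega
  rw [e, heq] at g1
  have hu := aux_unique _ (List.Palindrome.of_reverse_eq g1.1.2.2) _ _ g1 g2
  have hl := congrArg List.length hu
  simp only [List.length_append, List.length_reverse] at hl
  obtain ⟨-, e2⟩ := List.append_inj' hu (by omega)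
  rw [e2] at heq
  omega
end

section
/- Let T be a string of length N and c a half-position of T. Then the total number of blocks, summed over all maximal block palindromes of T whose center position is c, is at most N. -/
variable {α : Type*}

/-- Block palindrome factorization all of whose blocks are unbordered. -/
def UFact (S : List α) (L : List (List α)) : Prop :=
  BPFact S L ∧ ∀ f ∈ L, Unbordered f

theorem bordered_split (n : ℕ) : ∀ (D f : List α), D.length = n → IsBorder D f →
    ∃ D X : List α, D ≠ [] ∧ f = D ++ (X ++ D) := by
  induction n using Nat.strong_induction_on with
  | _ n ih =>
    intro D f hn hD
    obtain ⟨h0, hlt, hp, hs⟩ := hD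
    by_cases h2 : 2 * D.length ≤ f.length
    · obtain ⟨Y, rfl⟩ := hp
      have : D <:+ Y := by
        apply List.suffix_of_suffix_length_le hs (List.suffix_append D Y)
        simp at h2; omega
      obtain ⟨X, rfl⟩ := this
      exact ⟨D, X, h0, rfl⟩
    · have e1 : D = f.take D.length := List.prefix_iff_eq_take.1 hp
      have e2 : D = f.drop (f.length - D.length) := List.suffix_iff_eq_drop.1 hs
      have e3 : D.drop (f.length - D.length) = D.take (D.length - (f.length - D.length)) := by
        have e4 : D.drop (f.length - D.length)
            = (f.take D.length).drop (f.length - D.length) := by rw [← e1]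
        have e5 : D.take (D.length - (f.length - D.length))
            = (f.drop (f.length - D.length)).take (D.length - (f.length - D.length)) := by
          rw [← e2]
        rw [e4, e5, List.drop_take]
      have hl : (D.drop (f.length - D.length)).length = D.length - (f.length - D.length) := by simp
      refine ih _ ?_ (D.drop (f.length - D.length)) f rfl ⟨?_, ?_, ?_, ?_⟩
      · omega
      · intro h
        rw [h] at hl
        simp at hl
        omega
      · omega
      · rw [e3]
        exact (List.take_prefix _ _).trans hp
      · exact (List.drop_suffix _ _).trans hs

theorem length_flatMap_ge {β : Type*} (g : β → List β) (hg : ∀ x, 1 ≤ (g x).length) :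
    ∀ L : List β, L.length ≤ (L.flatMap g).length
  | [] => by simp
  | a :: L => by
    have := length_flatMap_ge g hg L
    have := hg a
    simp only [List.flatMap_cons, List.length_append, List.length_cons]
    omega

theorem length_flatMap_gt {β : Type*} (g : β → List β) (hg : ∀ x, 1 ≤ (g x).length)
    (b : β) (hb : 2 ≤ (g b).length) :
    ∀ L : List β, b ∈ L → L.length < (L.flatMap g).length
  | [], h => by simp at h
  | a :: L, h => by
    have h1 := length_flatMap_ge g hg L
    have h2 := hg a
    simp only [List.flatMap_cons, List.length_append, List.length_cons]
    rcases List.mem_cons.1 h with rfl | h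
    · omega
    · have := length_flatMap_gt g hg b hb L h
      omega

theorem flatten_flatMap_self {β : Type*} (g : List β → List (List β))
    (hg : ∀ x, (g x).flatten = x) :
    ∀ L : List (List β), (L.flatMap g).flatten = L.flatten
  | [] => by simp
  | a :: L => by
    simp only [List.flatMap_cons, List.flatten_append, List.flatten_cons, hg,
      flatten_flatMap_self g hg L]

theorem LargestBPF.ufact {S : List α} {L : List (List α)} (h : LargestBPF S L) : UFact S L := by
  classical
  refine ⟨h.1, fun f hf D hD => ?_⟩
  obtain ⟨D, X, h0, rfl⟩ := bordered_split _ D f rfl hD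
  obtain ⟨⟨hne, hfl, hrev⟩, hmax⟩ := h
  set g : List α → List (List α) := fun x =>
    if x = D ++ (X ++ D) then (if X = [] then [D, D] else [D, X, D]) else [x] with hgdef
  have hlen : ∀ x, 1 ≤ (g x).length := by
    intro x; simp only [hgdef]; split_ifs <;> simp
  have hlen2 : 2 ≤ (g (D ++ (X ++ D))).length := by
    simp only [hgdef]; split_ifs <;> simp
  have hflat : ∀ x, (g x).flatten = x := by
    intro x; simp only [hgdef]; split_ifs <;> simp_all
  have hgr : ∀ x, (g x).reverse = g x := by
    intro x; simp only [hgdef]; split_ifs <;> simp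
  have hgne : ∀ x, x ≠ [] → ∀ y ∈ g x, y ≠ [] := by
    intro x hx y; simp only [hgdef]; split_ifs <;> simp <;> grind
  have := hmax (L.flatMap g) ⟨?_, ?_, ?_⟩
  · have := length_flatMap_gt g hlen _ hlen2 L hf
    omega
  · intro y hy
    obtain ⟨x, hx, hy⟩ := List.mem_flatMap.1 hy
    exact hgne x (hne x hx) y hy
  · rw [flatten_flatMap_self g hflat, hfl]
  · rw [List.reverse_flatMap, hrev]
    congr 1
    funext x
    exact hgr x

theorem unbordered_heads {S B C : List α} (hB0 : B ≠ []) (hC0 : C ≠ [])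
    (hB : Unbordered B) (hC : Unbordered C) (b1 : B <+: S) (b2 : B <:+ S)
    (c1 : C <+: S) (c2 : C <:+ S) : B = C := by
  rcases lt_trichotomy B.length C.length with h | h | h
  · exact (hC B ⟨hB0, h, List.prefix_of_prefix_length_le b1 c1 h.le,
      List.suffix_of_suffix_length_le b2 c2 h.le⟩).elim
  · exact (List.prefix_of_prefix_length_le b1 c1 h.le).eq_of_length h
  · exact (hB C ⟨hC0, h, List.prefix_of_prefix_length_le c1 b1 h.le,
      List.suffix_of_suffix_length_le c2 b2 h.le⟩).elim

theorem UFact.strip {S B : List α} {M : List (List α)} (h : UFact S (B :: (M ++ [B]))) :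
    UFact M.flatten M := by
  obtain ⟨⟨h1, h2, h3⟩, h4⟩ := h
  refine ⟨⟨fun f hf => h1 f (by simp [hf]), rfl, ?_⟩, fun f hf => h4 f (by simp [hf])⟩
  simpa using h3

theorem UFact.data {S : List α} {L : List (List α)} (h : UFact S L) (B : List α)
    (hB : (∃ M, L = B :: M) ∧ (∃ M, L = M ++ [B])) :
    B ≠ [] ∧ Unbordered B ∧ B <+: S ∧ B <:+ S := by
  obtain ⟨⟨M, rfl⟩, ⟨M', e⟩⟩ := hB
  refine ⟨h.1.1 B (by simp), h.2 B (by simp), ?_, ?_⟩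
  · rw [← h.1.2.1]; simp
  · rw [← h.1.2.1, e]; simp

theorem UFact.unique {L : List (List α)} (hp : L.Palindrome) :
    ∀ {S : List α} {K : List (List α)}, UFact S L → UFact S K → L = K := by
  induction hp with
  | nil =>
    intro S K hL hK
    have e := hL.1.2.1.trans hK.1.2.1.symm
    cases K with
    | nil => rfl
    | cons a K => exact (hK.1.1 a (by simp) (by simp at e; exact e.1)).elim
  | singleton x =>
    intro S K hL hK
    have e := hL.1.2.1.trans hK.1.2.1.symm
    have dx := hL.data x ⟨⟨[], rfl⟩, ⟨[], rfl⟩⟩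
    cases List.Palindrome.of_reverse_eq hK.1.2.2 with
    | nil => simp at e; exact (dx.1 e).elim
    | singleton y => simp at e; rw [e]
    | @cons_concat y M hM =>
      have dy := hK.data y ⟨⟨_, rfl⟩, ⟨y :: M, rfl⟩⟩
      have := unbordered_heads dx.1 dy.1 dx.2.1 dy.2.1 dx.2.2.1 dx.2.2.2 dy.2.2.1 dy.2.2.2
      subst this
      simp at e
      exact (dx.1 e.2).elim
  | @cons_concat x M' hM' ih =>
    intro S K hL hK
    have e := hL.1.2.1.trans hK.1.2.1.symm
    have dx := hL.data x ⟨⟨_, rfl⟩, ⟨x :: M', rfl⟩⟩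
    cases List.Palindrome.of_reverse_eq hK.1.2.2 with
    | nil => simp at e; exact (dx.1 e.1).elim
    | singleton y =>
      have dy := hK.data y ⟨⟨[], rfl⟩, ⟨[], rfl⟩⟩
      have := unbordered_heads dx.1 dy.1 dx.2.1 dy.2.1 dx.2.2.1 dx.2.2.2 dy.2.2.1 dy.2.2.2
      subst this
      simp at e
      exact (dx.1 e.2).elim
    | @cons_concat y M hM =>
      have dy := hK.data y ⟨⟨_, rfl⟩, ⟨y :: M, rfl⟩⟩
      have := unbordered_heads dx.1 dy.1 dx.2.1 dy.2.1 dx.2.2.1 dx.2.2.2 dy.2.2.1 dy.2.2.2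
      subst this
      have e' : M'.flatten = M.flatten := by simpa using e
      have h2 := hK.strip
      rw [← e'] at h2
      rw [ih hL.strip h2]

/-- `r` is a level in the chain with center block starting at `p`. -/
def InChain (T : List α) (s p r : ℕ) : Prop :=
  2 * r < s ∧ s - r ≤ T.length ∧ ∃ L : List (List α), UFact (Substr T r (s - r)) L ∧
    p = r + ((L.take (L.length / 2)).flatten).length

open Classical in
/-- All the levels in the chain of `p`. -/
noncomputable def chainSet (T : List α) (s p : ℕ) : Finset ℕ :=
  (Finset.Ico (s - T.length) ((s + 1) / 2)).filter (InChain T s p)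

theorem mem_chainSet {T : List α} {s p r : ℕ} : r ∈ chainSet T s p ↔ InChain T s p r := by
  simp only [chainSet, Finset.mem_filter, Finset.mem_Ico]
  refine ⟨fun h => h.2, fun h => ⟨?_, h⟩⟩
  have h1 := h.1
  have h2 := h.2.1
  omega

theorem chainSet_disjoint {T : List α} {s p p' : ℕ} (h : p ≠ p') :
    Disjoint (chainSet T s p) (chainSet T s p') := by
  rw [Finset.disjoint_left]
  intro r h1 h2
  rw [mem_chainSet] at h1 h2
  obtain ⟨_, _, L, hL, rfl⟩ := h1
  obtain ⟨_, _, K, hK, rfl⟩ := h2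
  have := UFact.unique (List.Palindrome.of_reverse_eq hL.1.2.2) hL hK
  subst this
  exact h rfl

theorem length_Substr {T : List α} {b e : ℕ} (he : e ≤ T.length) :
    (Substr T b e).length = e - b := by
  simp [Substr]; omega

theorem Substr_strip {T B W : List α} {b e : ℕ}
    (h : Substr T b e = B ++ (W ++ B)) (he : e ≤ T.length) :
    Substr T (b + B.length) (e - B.length) = W := by
  have hl := length_Substr (b := b) he
  rw [h] at hl
  simp only [List.length_append] at hl
  have h1 : Substr T (b + B.length) (e - B.length)
      = ((Substr T b e).drop B.length).take W.length := by
    simp only [Substr, List.drop_take, List.drop_drop, List.take_take]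
    congr 1
    omega
  rw [h1, h]
  simp

theorem chain_card {L : List (List α)} (hp : L.Palindrome) :
    ∀ (T : List α) (s p r : ℕ), r ≤ s → s - r ≤ T.length → UFact (Substr T r (s - r)) L →
    p = r + ((L.take (L.length / 2)).flatten).length →
    (L.length + 1) / 2 ≤ ((chainSet T s p).filter (r ≤ ·)).card := by
  induction hp with
  | nil => intros; simp
  | singleton x =>
    intro T s p r hr hs hU hpr
    have : r ∈ (chainSet T s p).filter (r ≤ ·) := by
      rw [Finset.mem_filter, mem_chainSet]
      refine ⟨⟨?_, hs, _, hU, hpr⟩, le_rfl⟩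
      have h1 := hU.1.1 x (by simp)
      have h2 := congrArg List.length hU.1.2.1
      rw [length_Substr hs] at h2
      have := List.length_pos_iff.2 h1
      simp at h2
      omega
    have := Finset.card_pos.2 ⟨r, this⟩
    simpa using this
  | @cons_concat x M hM ih =>
    intro T s p r hr hs hU hpr
    have h1 := List.length_pos_iff.2 (hU.1.1 x (by simp))
    have h2 := congrArg List.length hU.1.2.1
    rw [length_Substr hs] at h2
    simp only [List.flatten_cons, List.flatten_append, List.length_append, List.flatten_nil,
      List.length_nil] at h2
    have hmem : r ∈ (chainSet T s p).filter (r ≤ ·) := by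
      rw [Finset.mem_filter, mem_chainSet]
      exact ⟨⟨by omega, hs, _, hU, hpr⟩, le_rfl⟩
    have hsub : Substr T (r + x.length) (s - (r + x.length)) = M.flatten := by
      have := Substr_strip (T := T) (B := x) (W := M.flatten) (b := r) (e := s - r)
        (by rw [← hU.1.2.1]; simp) hs
      rwa [Nat.sub_sub] at this
    have hU' := hU.strip
    rw [← hsub] at hU'
    have htake : p = r + x.length + ((M.take (M.length / 2)).flatten).length := by
      rw [hpr]
      have : (x :: (M ++ [x])).length / 2 = M.length / 2 + 1 := by simp; omega
      rw [this, List.take_succ_cons, List.take_append_of_le_length (by omega)]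
      simp
      omega
    have key := ih T s p (r + x.length) (by omega) (by omega) hU' htake
    have hlt : ((chainSet T s p).filter (r + x.length ≤ ·)).card
        < ((chainSet T s p).filter (r ≤ ·)).card := by
      apply Finset.card_lt_card
      rw [Finset.ssubset_iff_of_subset]
      · refine ⟨r, hmem, ?_⟩
        simp only [Finset.mem_filter, not_and, not_le]
        intro _
        omega
      · intro a ha
        simp only [Finset.mem_filter] at ha ⊢
        exact ⟨ha.1, by omega⟩
    have : (x :: (M ++ [x])).length = M.length + 2 := by simp
    rw [this]
    omega

theorem memF_card {T : List α} {s p q : ℕ} {L : List (List α)} (hs : p + q = s)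
    (h : MemF T p q L) : (L.length + 1) / 2 ≤ (chainSet T s p).card := by
  obtain ⟨hpq, hq, h0, k, hk, hqk, hL, hkl, -⟩ := h
  have hU := hL.ufact
  have e : q + k = s - (p - k) := by omega
  rw [e] at hU
  refine (chain_card (List.Palindrome.of_reverse_eq hU.1.2.2) T s p (p - k) (by omega) (by omega)
    hU ?_).trans (Finset.card_filter_le _ _)
  have : ((L.take (L.length / 2)).flatten).length = k := by
    rw [hkl]
    have e1 : L.drop ((L.length + 1) / 2) = (L.take (L.length / 2)).reverse := by
      conv_rhs => rw [← hU.1.2.2, List.take_reverse, List.reverse_reverse, List.length_reverse]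
      congr 1
      omega
    rw [e1]
    simp [List.length_flatten, List.map_reverse, List.sum_reverse]
  omega

/-- For a string `T` of length `N` and a half-position `c` of `T` (encoded by
`s = 2c - 1 ∈ {1, …, 2N - 1}`, so that a center block occupying `[p, q)` in 0-based
half-open coordinates has center `c` iff `p + q = s`), the total number of blocks,
summed over all maximal block palindromes of `T` whose center position is `c`, is at
most `N`.  The function `F` picks, for each center-block interval `[p, q)`, the maximal
block palindrome of `F_T(c, d)` if one exists, and `[]` (contributing `0`) otherwise. -/
theorem sum_sizes_fixed_center_le (T : List α) (s : ℕ)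
    (hs1 : 1 ≤ s) (hs2 : s ≤ 2 * T.length - 1)
    (F : ℕ → ℕ → List (List α))
    (hF : ∀ p q, (∃ L, MemF T p q L) → MaximalBP T p q (F p q))
    (hF0 : ∀ p q, ¬ (∃ L, MemF T p q L) → F p q = []) :
    ∑ p ∈ Finset.range (T.length + 1), ∑ q ∈ Finset.range (T.length + 1),
      (if p + q = s then (F p q).length else 0) ≤ T.length := by
  have hchain : ∑ p ∈ Finset.range (T.length + 1), (chainSet T s p).card
      ≤ (s + 1) / 2 - (s - T.length) := by
    rw [← Finset.card_biUnion (fun a _ b _ hab => chainSet_disjoint hab), ← Nat.card_Ico]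
    apply Finset.card_le_card
    intro r hr
    obtain ⟨p, -, hr⟩ := Finset.mem_biUnion.1 hr
    have h1 := (mem_chainSet.1 hr).1
    have h2 := (mem_chainSet.1 hr).2.1
    rw [Finset.mem_Ico]
    omega
  -- each inner sum is at most twice the chain size, strictly if `s` is odd and it is nonzero
  have hterm : ∀ p q, p + q = s → (F p q).length ≤ 2 * (chainSet T s p).card ∧
      (Odd s → (F p q).length ≠ 0 → (F p q).length < 2 * (chainSet T s p).card) := by
    intro p q hpq
    by_cases hex : ∃ L, MemF T p q L
    · have hm := (hF p q hex).1
      have hc := memF_card hpq hm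
      refine ⟨by omega, fun hodd _ => ?_⟩
      obtain ⟨_, _, _, _, _, _, _, _, h | h⟩ := hm
      · obtain ⟨a, ha⟩ := hodd
        omega
      · obtain ⟨a, ha⟩ := h.2.1
        omega
    · rw [hF0 p q hex]
      simp
  have hinner : ∀ p, (∑ q ∈ Finset.range (T.length + 1),
      (if p + q = s then (F p q).length else 0)) ≤ 2 * (chainSet T s p).card ∧
      (Odd s → (∑ q ∈ Finset.range (T.length + 1),
      (if p + q = s then (F p q).length else 0)) ≠ 0 →
      (∑ q ∈ Finset.range (T.length + 1),
      (if p + q = s then (F p q).length else 0)) < 2 * (chainSet T s p).card) := by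
    intro p
    by_cases hz : ∃ q ∈ Finset.range (T.length + 1), p + q = s
    · obtain ⟨q, hq, hpq⟩ := hz
      rw [Finset.sum_eq_single_of_mem q hq (fun b _ hb => by rw [if_neg (by omega)]), if_pos hpq]
      exact hterm p q hpq
    · push Not at hz
      rw [Finset.sum_eq_zero (fun q hq => by rw [if_neg (hz q hq)])]
      simp
  have hle : ∑ p ∈ Finset.range (T.length + 1), ∑ q ∈ Finset.range (T.length + 1),
      (if p + q = s then (F p q).length else 0)
      ≤ 2 * ∑ p ∈ Finset.range (T.length + 1), (chainSet T s p).card := by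
    rw [Finset.mul_sum]
    exact Finset.sum_le_sum fun p _ => (hinner p).1
  rcases Nat.even_or_odd s with he | ho
  · obtain ⟨m, hm⟩ := he
    omega
  · by_cases hz : ∃ p ∈ Finset.range (T.length + 1), (∑ q ∈ Finset.range (T.length + 1),
      (if p + q = s then (F p q).length else 0)) ≠ 0
    · obtain ⟨p, hp, hne⟩ := hz
      have hlt : ∑ p ∈ Finset.range (T.length + 1), ∑ q ∈ Finset.range (T.length + 1),
          (if p + q = s then (F p q).length else 0)
          < 2 * ∑ p ∈ Finset.range (T.length + 1), (chainSet T s p).card := by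
        rw [Finset.mul_sum]
        exact Finset.sum_lt_sum (fun p _ => (hinner p).1) ⟨p, hp, (hinner p).2 ho hne⟩
      obtain ⟨m, hm⟩ := ho
      omega
    · push Not at hz
      rw [Finset.sum_eq_zero hz]
      omega
end

section
/- Let T be a string of length N, let b be a position of T, and let b₁ be the smallest position with b < b₁ ≤ N and T[b₁] = T[b]. Then for every integer ℓ with 1 ≤ ℓ ≤ min(LCE_T(b, b₁), b₁ − b), the substring T[b .. b+ℓ−1] (which equals T[b₁ .. b₁+ℓ−1]) is unbordered. -/
variable {α : Type*}

/-- The length of the longest common prefix of two lists. -/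
def lcpLen [DecidableEq α] : List α → List α → ℕ
  | x :: s, y :: t => if x = y then lcpLen s t + 1 else 0
  | _, _ => 0

/-- `LCE T i j`: for 1-based positions `i, j` of `T`, the length of the longest common
prefix of the suffixes `T[i..N]` and `T[j..N]`. -/
def LCE [DecidableEq α] (T : List α) (i j : ℕ) : ℕ :=
  lcpLen (T.drop (i - 1)) (T.drop (j - 1))

theorem take_eq_of_le_lcpLen [DecidableEq α] : ∀ (s t : List α) (n : ℕ), n ≤ lcpLen s t →
    s.take n = t.take n
  | [], [], n, _ => rfl
  | [], y :: t, n, h => by simp [lcpLen] at h; simp [h]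
  | x :: s, [], n, h => by simp [lcpLen] at h; simp [h]
  | x :: s, y :: t, 0, _ => by simp
  | x :: s, y :: t, n + 1, h => by
      unfold lcpLen at h
      split_ifs at h with hxy
      · simp [hxy, take_eq_of_le_lcpLen s t n (by omega)]
      · omega

/-- Let `T` be a string of length `N`, let `b` be a (1-based) position of `T`, and let
`b₁` be the smallest position with `b < b₁ ≤ N` and `T[b₁] = T[b]`.  Then for every
integer `ℓ` with `1 ≤ ℓ ≤ min (LCE_T(b, b₁)) (b₁ - b)`, the substring `T[b .. b+ℓ-1]`
(which equals `T[b₁ .. b₁+ℓ-1]`) is unbordered. -/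
theorem unbordered_common_prefix [DecidableEq α] (T : List α) (b b₁ : ℕ)
    (hb : 1 ≤ b) (hbN : b ≤ T.length)
    (hbb₁ : b < b₁) (hb₁N : b₁ ≤ T.length)
    (heq : T[b₁ - 1]? = T[b - 1]?)
    (hmin : ∀ b', b < b' → b' < b₁ → T[b' - 1]? ≠ T[b - 1]?) :
    ∀ ℓ : ℕ, 1 ≤ ℓ → ℓ ≤ min (LCE T b b₁) (b₁ - b) →
      (T.drop (b - 1)).take ℓ = (T.drop (b₁ - 1)).take ℓ ∧
      Unbordered ((T.drop (b - 1)).take ℓ) := by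
  intro ℓ h1 h2
  have hL : ℓ ≤ LCE T b b₁ := le_trans h2 (min_le_left _ _)
  have hd : ℓ ≤ b₁ - b := le_trans h2 (min_le_right _ _)
  refine ⟨take_eq_of_le_lcpLen _ _ _ hL, ?_⟩
  rintro B ⟨hne, hlt, hp, hs⟩
  have hlen : ((T.drop (b - 1)).take ℓ).length = ℓ := by
    simp only [List.length_take, List.length_drop]; omega
  obtain ⟨u, hu⟩ := hp
  obtain ⟨v, hv⟩ := hs
  have hBpos : 0 < B.length := List.length_pos_iff.mpr hne
  have hvl : v.length + B.length = ℓ := by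
    rw [← hlen, ← hv, List.length_append]
  have e1 : ((T.drop (b - 1)).take ℓ)[0]? = B[0]? := by
    rw [← hu, List.getElem?_append_left hBpos]
  have e2 : ((T.drop (b - 1)).take ℓ)[v.length]? = B[0]? := by
    rw [← hv, List.getElem?_append_right le_rfl, Nat.sub_self]
  rw [List.getElem?_take_of_lt (by omega), List.getElem?_drop] at e1 e2
  rw [hlen] at hlt
  apply hmin (b + v.length) (by omega) (by omega)
  rw [show b + v.length - 1 = b - 1 + v.length by omega, e2, ← e1, Nat.add_zero]
end
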